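/- There exists c > 0 such that for every φ ∈ 𝒪¹(ℂ̄∖[0,1]) and every z ∈ D₁∖{1}: |(Tφ)(z) + z·φ(1/z − 1) − Σ_{m≥1} φ′(−m)| ≤ c·|z − 1|·sup_{D∞} |φ|, and |Σ_ℳ φ(z) − φ(z) + z·φ(1/z − 1)| ≤ c·|z − 1|·(1 + log |z − 1|⁻¹)·sup_{D∞} |φ|. -/

import Mathlib

open Complex Filter Set Topology
open scoped ENNReal NNReal

noncomputable section

/-- The complement in `ℂ` of the real segment `[a, b]`. -/
def cutPlane (a b : ℝ) : Set ℂ := (Complex.ofReal '' Set.Icc a b)ᶜ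

/-- `𝒪¹(ℂ̄ ∖ [a,b])`: holomorphic on `ℂ ∖ [a,b]`, vanishing at infinity. -/
def O1 (a b : ℝ) : Set (ℂ → ℂ) :=
  {φ | DifferentiableOn ℂ φ (cutPlane a b) ∧
       Tendsto φ (Bornology.cobounded ℂ) (nhds 0)}

/-- `𝒪³(ℂ̄ ∖ [a,b])`: holomorphic on `ℂ ∖ [a,b]`, with `z²ψ(z) → 0` at infinity. -/
def O3 (a b : ℝ) : Set (ℂ → ℂ) :=
  {ψ | DifferentiableOn ℂ ψ (cutPlane a b) ∧
       Tendsto (fun z => z ^ 2 * ψ z) (Bornology.cobounded ℂ) (nhds 0)}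

/-- The `m`-th term (for the integer `m+1 ≥ 1`) of the series defining `T`. -/
def Tterm (φ : ℂ → ℂ) (m : ℕ) (z : ℂ) : ℂ :=
  -z * (φ (z⁻¹ - ((m : ℂ) + 1)) - φ (-((m : ℂ) + 1))) + deriv φ (-((m : ℂ) + 1))

/-- The operator `T`. -/
def Tbrj (φ : ℂ → ℂ) : ℂ → ℂ := fun z => ∑' m : ℕ, Tterm φ m z

/-- The operator `T⁽³⁾`. -/
def T3brj (ψ : ℂ → ℂ) : ℂ → ℂ := fun z => -∑' m : ℕ, (z⁻¹) ^ 3 * ψ (z⁻¹ - ((m : ℂ) + 1))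

/-- `g(m) = (0 1; 1 m)`. -/
def gmat (m : ℤ) : Matrix (Fin 2) (Fin 2) ℤ := !![0, 1; 1, m]

/-- The monoid `ℳ`. -/
def Mmon : Set (Matrix (Fin 2) (Fin 2) ℤ) :=
  {g | g = 1 ∨
    ((g 0 0 * g 1 1 - g 0 1 * g 1 0 = 1 ∨ g 0 0 * g 1 1 - g 0 1 * g 1 0 = -1) ∧
      g 0 1 ≤ g 1 1 ∧ g 0 0 ≤ g 0 1 ∧ 0 ≤ g 0 0 ∧ g 1 0 ≤ g 1 1 ∧ g 0 0 ≤ g 1 0)}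

/-- The operator `L_g` on `𝒪¹(ℂ̄ ∖ [0,1])`, for `g = (a b; c d) ∈ ℳ`. -/
def Lop (g : Matrix (Fin 2) (Fin 2) ℤ) (φ : ℂ → ℂ) : ℂ → ℂ := fun z =>
  if g = 1 then φ z
  else
    ((g 0 0 : ℂ) - (g 1 0 : ℂ) * z) *
        (φ (((g 1 1 : ℂ) * z - (g 0 1 : ℂ)) / ((g 0 0 : ℂ) - (g 1 0 : ℂ) * z)) -
          φ (-(g 1 1 : ℂ) / (g 1 0 : ℂ))) -
      ((g 0 0 * g 1 1 - g 0 1 * g 1 0 : ℤ) : ℂ) * ((g 1 0 : ℂ))⁻¹ *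
        deriv φ (-(g 1 1 : ℂ) / (g 1 0 : ℂ))

/-- `Σ_ℳ φ`, the sum of the family `(L_g φ)_{g ∈ ℳ}`. -/
def sumM (φ : ℂ → ℂ) : ℂ → ℂ := fun z => ∑' g : Mmon, Lop g.1 φ z

/-- The domain `D`. -/
def Dset : Set ℂ :=
  {z | ‖z‖ ≤ 1 ∧ 1 ≤ ‖z - Complex.I‖ ∧ 1 ≤ ‖z + Complex.I‖ ∧ 0 < z.re}

/-- The domain `D₀`. -/
def D0set : Set ℂ := {z | ‖z + 1‖ ≤ 1 ∧ Real.sqrt 3 / 2 - 1 ≤ z.re}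

/-- The domain `D₁`. -/
def D1set : Set ℂ :=
  {z | 1 ≤ ‖z‖ ∧ ‖z - (1 / Real.sqrt 3 : ℝ)‖ ≤ 1 / Real.sqrt 3}

/-- The domain `H₀`. -/
def H0set : Set ℂ := {z | ‖z - Complex.I‖ ≤ 1 ∧ 1 ≤ ‖z + 1‖ ∧ z.im ≤ 1 / 2}

/-- The domain `H₀′`. -/
def H0set' : Set ℂ := {z | (starRingEnd ℂ) z ∈ H0set}

/-- The domain `Δ`. -/
def Δset : Set ℂ := {z | ‖z‖ ≤ 1 ∧ 1 ≤ ‖z + 1‖ ∧ |z.im| ≤ 1 / 2}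

/-- The domain `D∞`. -/
def Dinf : Set ℂ :=
  {z | 1 / 2 < |z.im|} ∪ {z | z.re < Real.sqrt 3 / 2 - 1} ∪
    {z | Real.sqrt 3 / 2 < z.re ∧ 1 / Real.sqrt 3 < ‖z - (1 / Real.sqrt 3 : ℝ)‖}

end

/-- Holomorphy on the half-plane `Re w < -1/7` together with the decay `‖f w‖ ≤ K / ‖w‖`. -/
def HalfPlaneDecay (f : ℂ → ℂ) (K : ℝ) : Prop :=
  DifferentiableOn ℂ f {w | w.re < -(1 / 7)} ∧ ∀ w : ℂ, w.re < -(1 / 7) → ‖f w‖ ≤ K / ‖w‖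

lemma norm_deriv_le_of_re_le {f : ℂ → ℂ} {a C : ℝ} (hf : DifferentiableOn ℂ f {w | w.re < a})
    {w : ℂ} {ρ : ℝ} (hρ : 0 < ρ) (hw : w.re + ρ < a)
    (hC : ∀ v : ℂ, v.re ≤ w.re + ρ → ‖f v‖ ≤ C) : ‖deriv f w‖ ≤ C / ρ := by
  have key : ∀ v ∈ Metric.closedBall w ρ, v.re ≤ w.re + ρ := by
    intro v hv
    have h1 := (Complex.abs_re_le_norm (v - w)).trans (by simpa [dist_eq_norm] using hv)
    have h2 := (abs_le.1 h1).2
    simp at h2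
    linarith
  apply Complex.norm_deriv_le_of_forall_mem_sphere_norm_le hρ
  · apply DifferentiableOn.diffContOnCl
    rw [closure_ball _ hρ.ne']
    exact hf.mono fun v hv => (key v hv).trans_lt hw
  · exact fun v hv => hC v (key v (Metric.sphere_subset_closedBall hv))

namespace HalfPlaneDecay

variable {f : ℂ → ℂ} {K : ℝ}

lemma nonneg (hf : HalfPlaneDecay f K) : 0 ≤ K := by
  have := (norm_nonneg _).trans (hf.2 (-1) (by norm_num))
  simpa using this

lemma norm_le (hf : HalfPlaneDecay f K) {r : ℝ} (hr : 1 / 7 < r) {w : ℂ} (hw : w.re ≤ -r) :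
    ‖f w‖ ≤ K / r := by
  refine (hf.2 w (by linarith)).trans ?_
  have h1 := Complex.abs_re_le_norm w
  rw [abs_of_nonpos (by linarith)] at h1
  have := hf.nonneg
  gcongr
  linarith

lemma differentiableAt (hf : HalfPlaneDecay f K) {w : ℂ} (hw : w.re < -(1 / 7)) :
    DifferentiableAt ℂ f w :=
  hf.1.differentiableAt ((isOpen_re_lt _).mem_nhds hw)

lemma norm_deriv_le (hf : HalfPlaneDecay f K) {r : ℝ} (hr : 1 / 2 ≤ r) {w : ℂ} (hw : w.re ≤ -r) :
    ‖deriv f w‖ ≤ 4 * K / r ^ 2 := by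
  have h := norm_deriv_le_of_re_le hf.1 (ρ := r / 2) (by linarith) (by linarith) (w := w)
    (C := K / (r / 2)) (fun v hv => hf.norm_le (by linarith) (by linarith))
  refine h.trans (le_of_eq ?_)
  field_simp
  ring

lemma norm_deriv_deriv_le (hf : HalfPlaneDecay f K) {r : ℝ} (hr : 1 ≤ r) {w : ℂ}
    (hw : w.re ≤ -r) : ‖deriv (deriv f) w‖ ≤ 32 * K / r ^ 3 := by
  have h := norm_deriv_le_of_re_le (hf.1.deriv (isOpen_re_lt _)) (ρ := r / 2) (by linarith)
    (by linarith) (w := w) (C := 4 * K / (r / 2) ^ 2)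
    (fun v hv => hf.norm_deriv_le (by linarith) (by linarith))
  refine h.trans (le_of_eq ?_)
  field_simp
  ring

lemma norm_le' (hf : HalfPlaneDecay f K) {w : ℂ} (hw : w.re < -(1 / 7)) : ‖f w‖ ≤ 7 * K := by
  have h1 := Complex.abs_re_le_norm w
  rw [abs_of_nonpos (by linarith)] at h1
  have := hf.nonneg
  refine (hf.2 w hw).trans ?_
  rw [div_le_iff₀ (by linarith)]
  nlinarith

lemma norm_sub_le (hf : HalfPlaneDecay f K) {r : ℝ} (hr : 1 / 2 ≤ r) {u v : ℂ}
    (hu : u.re ≤ -r) (hv : v.re ≤ -r) : ‖f u - f v‖ ≤ 4 * K / r ^ 2 * ‖u - v‖ :=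
  Convex.norm_image_sub_le_of_norm_deriv_le (s := {w : ℂ | w.re ≤ -r})
    (fun _ hx => hf.differentiableAt (lt_of_le_of_lt hx (by linarith)))
    (fun _ hx => hf.norm_deriv_le hr hx) (convex_halfSpace_re_le _) hv hu

lemma norm_deriv_sub_le (hf : HalfPlaneDecay f K) {r : ℝ} (hr : 1 ≤ r) {u v : ℂ}
    (hu : u.re ≤ -r) (hv : v.re ≤ -r) :
    ‖deriv f u - deriv f v‖ ≤ 32 * K / r ^ 3 * ‖u - v‖ :=
  Convex.norm_image_sub_le_of_norm_deriv_le (s := {w : ℂ | w.re ≤ -r})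
    (fun _ hx => (hf.1.deriv (isOpen_re_lt _)).differentiableAt
      ((isOpen_re_lt _).mem_nhds (lt_of_le_of_lt hx (by linarith : -r < -(1 / 7)))))
    (fun _ hx => hf.norm_deriv_deriv_le hr hx) (convex_halfSpace_re_le _) hv hu

lemma norm_taylor_le (hf : HalfPlaneDecay f K) {r : ℝ} (hr : 1 ≤ r) {u v : ℂ}
    (hu : u.re ≤ -r) (hv : v.re ≤ -r) :
    ‖f u - f v - deriv f v * (u - v)‖ ≤ 32 * K / r ^ 3 * ‖u - v‖ ^ 2 := by
  have hK := hf.nonneg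
  have hd : ∀ x : ℂ, x.re ≤ -r →
      HasDerivAt (fun x => f x - deriv f v * x) (deriv f x - deriv f v) x := fun x hx => by
    have h1 := (hf.differentiableAt (w := x) (by linarith)).hasDerivAt
    have h2 := (hasDerivAt_id' x).const_mul (deriv f v)
    rw [mul_one] at h2
    exact h1.sub h2
  have h := Convex.norm_image_sub_le_of_norm_deriv_le
    (f := fun x => f x - deriv f v * x) (C := 32 * K / r ^ 3 * ‖u - v‖)
    (s := {w : ℂ | w.re ≤ -r} ∩ Metric.closedBall v ‖u - v‖)
    (fun x hx => (hd x hx.1).differentiableAt) ?_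
    ((convex_halfSpace_re_le _).inter (convex_closedBall _ _)) (x := v) (y := u)
    ⟨hv, by simp⟩ ⟨hu, by simp [dist_eq_norm]⟩
  · convert h using 1
    · congr 1
      ring
    · ring
  · intro x hx
    rw [(hd x hx.1).deriv]
    refine (hf.norm_deriv_sub_le hr hx.1 hv).trans ?_
    gcongr
    simpa [dist_eq_norm] using hx.2

end HalfPlaneDecay

lemma mem_Dinf_of_two_lt_norm {w : ℂ} (hw : 2 < ‖w‖) : w ∈ Dinf := by
  by_contra h
  simp only [Dinf, mem_union, mem_ofPred_eq, not_or, not_lt, not_and] at h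
  obtain ⟨⟨him, hre⟩, h3⟩ := h
  have hs : Real.sqrt 3 ^ 2 = 3 := Real.sq_sqrt (by norm_num)
  have hs0 := Real.sqrt_nonneg 3
  have h4 : |w.re| ≤ 3 / 2 := by
    by_cases hc : Real.sqrt 3 / 2 < w.re
    · have h5 := (Complex.abs_re_le_norm _).trans (h3 hc)
      have h6 := (abs_le.1 h5).2
      simp only [Complex.sub_re, Complex.ofReal_re] at h6
      have h7 : 1 / Real.sqrt 3 ≤ 3 / 4 := by
        rw [div_le_iff₀ (by positivity)]
        nlinarith
      rw [abs_le]
      constructor <;> nlinarith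
    · rw [abs_le]
      constructor <;> nlinarith
  have h8 := Complex.norm_le_abs_re_add_abs_im w
  linarith

lemma re_lt_mem_Dinf {w : ℂ} (hw : w.re < -(1 / 7)) : w ∈ Dinf := by
  refine Or.inl (Or.inr ?_)
  have hs : Real.sqrt 3 ^ 2 = 3 := Real.sq_sqrt (by norm_num)
  have hs0 := Real.sqrt_nonneg 3
  show w.re < Real.sqrt 3 / 2 - 1
  nlinarith

lemma mem_cutPlane_of_re_neg {a b : ℝ} (ha : 0 ≤ a) {w : ℂ} (hw : w.re < 0) :
    w ∈ cutPlane a b := by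
  rintro ⟨x, hx, rfl⟩
  simp at hw
  linarith [hx.1]

lemma mem_cutPlane_of_one_lt_norm {w : ℂ} (hw : 1 < ‖w‖) : w ∈ cutPlane 0 1 := by
  rintro ⟨x, hx, rfl⟩
  rw [Complex.norm_real, Real.norm_of_nonneg hx.1] at hw
  linarith [hx.2]

/-- Schwarz lemma at infinity. -/
lemma norm_le_of_mem_O1 {φ : ℂ → ℂ} (hφ : φ ∈ O1 0 1) {M : ℝ} (hM : ∀ w ∈ Dinf, ‖φ w‖ ≤ M)
    {w : ℂ} (hw : 2 < ‖w‖) : ‖φ w‖ ≤ 2 * M / ‖w‖ := by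
  have hM0 : 0 ≤ M := (norm_nonneg _).trans (hM w (mem_Dinf_of_two_lt_norm hw))
  set F : ℂ → ℂ := Function.update (fun u => φ u⁻¹) 0 0 with hF
  have hFne : ∀ u ≠ 0, F u = φ u⁻¹ := fun u hu => by simp [hF, hu]
  have hF0 : F 0 = 0 := by simp [hF]
  have hball : ∀ u ∈ Metric.ball (0 : ℂ) (1 / 2), u ≠ 0 → 2 < ‖u⁻¹‖ := by
    intro u hu h0
    rw [norm_inv]
    rw [mem_ball_zero_iff] at hu
    rw [lt_inv_comm₀ (by norm_num) (norm_pos_iff.2 h0)]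
    linarith
  have hd : DifferentiableOn ℂ F (Metric.ball 0 (1 / 2)) := by
    rw [← Complex.differentiableOn_compl_singleton_and_continuousAt_iff
      (Metric.ball_mem_nhds (0 : ℂ) (by norm_num : (0 : ℝ) < 1 / 2))]
    constructor
    · have : DifferentiableOn ℂ (fun u => φ u⁻¹) (Metric.ball (0 : ℂ) (1 / 2) \ {0}) := by
        refine hφ.1.comp (differentiableOn_inv.mono fun u hu => hu.2) ?_
        intro u hu
        exact mem_cutPlane_of_one_lt_norm ((by norm_num : (1 : ℝ) < 2).trans (hball u hu.1 hu.2))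
      exact this.congr fun u hu => hFne u hu.2
    · rw [hF, continuousAt_update_same]
      exact hφ.2.comp Filter.tendsto_inv₀_nhdsNE_zero
  have hm : MapsTo F (Metric.ball 0 (1 / 2)) (Metric.closedBall (F 0) M) := by
    intro u hu
    rw [hF0, mem_closedBall_zero_iff]
    by_cases h0 : u = 0
    · rw [h0, hF0]; simpa
    · rw [hFne u h0]
      exact hM _ (mem_Dinf_of_two_lt_norm (hball u hu h0))
  have hw0 : w ≠ 0 := by rintro rfl; norm_num at hw
  have h := Complex.dist_le_div_mul_dist_of_mapsTo_ball hd hm (z := w⁻¹) (by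
    rw [mem_ball_zero_iff, norm_inv, inv_lt_comm₀ (by positivity) (by norm_num)]
    linarith)
  rw [hF0, dist_zero_right, dist_zero_right, hFne _ (inv_ne_zero hw0), inv_inv, norm_inv] at h
  refine h.trans (le_of_eq ?_)
  field_simp

lemma halfPlaneDecay_of_mem_O1 {φ : ℂ → ℂ} (hφ : φ ∈ O1 0 1) {M : ℝ}
    (hM : ∀ w ∈ Dinf, ‖φ w‖ ≤ M) : HalfPlaneDecay φ (2 * M) := by
  refine ⟨hφ.1.mono fun w hw => mem_cutPlane_of_re_neg le_rfl
    (lt_of_lt_of_le hw (by norm_num)), fun w hw => ?_⟩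
  by_cases h : 2 < ‖w‖
  · exact norm_le_of_mem_O1 hφ hM h
  · have hw0 : 0 < ‖w‖ := norm_pos_iff.2 (by rintro rfl; norm_num at hw)
    have h1 := hM w (re_lt_mem_Dinf hw)
    rw [le_div_iff₀ hw0]
    nlinarith [norm_nonneg (φ w)]

lemma summable_one_div_succ_sq : Summable fun m : ℕ => 1 / ((m : ℝ) + 1) ^ 2 := by
  simpa using (summable_nat_add_iff 1).2 (Real.summable_one_div_nat_pow.2 one_lt_two)

lemma sum_range_one_div_sq_le {N : ℕ} (hN : 1 ≤ N) (n : ℕ) :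
    ∑ i ∈ Finset.range n, 1 / (((i + N : ℕ) : ℝ) + 1) ^ 2 ≤ 1 / (N : ℝ) - 1 / ((n + N : ℕ) : ℝ) := by
  have hN' : (1 : ℝ) ≤ N := by exact_mod_cast hN
  induction n with
  | zero => simp
  | succ n ih =>
    rw [Finset.sum_range_succ]
    have h : 1 / (((n + N : ℕ) : ℝ) + 1) ^ 2 ≤
        1 / ((n + N : ℕ) : ℝ) - 1 / ((n + 1 + N : ℕ) : ℝ) := by
      have h0 : (0 : ℝ) < ((n + N : ℕ) : ℝ) := by exact_mod_cast (by omega : 0 < n + N)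
      have h1 : ((n + 1 + N : ℕ) : ℝ) = ((n + N : ℕ) : ℝ) + 1 := by push_cast; ring
      rw [h1, div_sub_div _ _ h0.ne' (by positivity), div_le_div_iff₀ (by positivity) (by positivity)]
      nlinarith
    linarith

lemma tsum_le_log {x : ℕ → ℝ} {K R : ℝ} (hR : 1 ≤ R) (hx0 : ∀ m, 0 ≤ x m)
    (h1 : ∀ m : ℕ, x m ≤ 2 * K / (m + 1)) (h2 : ∀ m : ℕ, x m ≤ 4 * K / (m + 1) ^ 2 * R) :
    ∑' m, x m ≤ 8 * K * (1 + Real.log R) := by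
  have hK : 0 ≤ K := by
    have := (hx0 0).trans (h1 0)
    norm_num at this
    linarith
  have h2' : ∀ m : ℕ, x m ≤ 4 * K * R * (1 / ((m : ℝ) + 1) ^ 2) := fun m =>
    (h2 m).trans (le_of_eq (by ring))
  have hs : Summable x := Summable.of_nonneg_of_le hx0 h2'
    (summable_one_div_succ_sq.mul_left _)
  set N := ⌈R⌉₊ with hN
  have hRN : R ≤ N := Nat.le_ceil R
  have hNR : (N : ℝ) ≤ R + 1 := (Nat.ceil_lt_add_one (by linarith)).le
  have hN1 : (1 : ℝ) ≤ N := hR.trans hRN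
  rw [← hs.sum_add_tsum_nat_add N]
  have ha : ∑ i ∈ Finset.range N, x i ≤ 4 * K * (1 + Real.log R) := by
    have hh := harmonic_le_one_add_log N
    have hlog : Real.log N ≤ Real.log 2 + Real.log R := by
      rw [← Real.log_mul (by norm_num) (by linarith)]
      exact Real.log_le_log (by linarith) (by linarith)
    have hl2 : Real.log 2 ≤ 1 := by linarith [Real.log_two_lt_d9]
    have hlR := Real.log_nonneg hR
    have hsum : ∑ i ∈ Finset.range N, x i ≤ 2 * K * (harmonic N : ℝ) := by
      rw [harmonic]
      push_cast
      rw [Finset.mul_sum]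
      exact Finset.sum_le_sum fun i _ => h1 i
    have : 2 * K * (harmonic N : ℝ) ≤ 2 * K * (2 * (1 + Real.log R)) := by
      gcongr
      linarith
    linarith
  have hb : ∑' i, x (i + N) ≤ 4 * K := by
    refine Real.tsum_le_of_sum_range_le (fun i => hx0 _) fun n => ?_
    calc ∑ i ∈ Finset.range n, x (i + N)
        ≤ ∑ i ∈ Finset.range n, 4 * K * R * (1 / (((i + N : ℕ) : ℝ) + 1) ^ 2) :=
          Finset.sum_le_sum fun i _ => h2' _
      _ = 4 * K * R * ∑ i ∈ Finset.range n, 1 / (((i + N : ℕ) : ℝ) + 1) ^ 2 := by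
          rw [Finset.mul_sum]
      _ ≤ 4 * K * R * (1 / (N : ℝ)) := by
          gcongr
          refine (sum_range_one_div_sq_le (by exact_mod_cast hN1) n).trans ?_
          have : (0 : ℝ) ≤ 1 / ((n + N : ℕ) : ℝ) := by positivity
          linarith
      _ ≤ 4 * K := by
          rw [mul_one_div, div_le_iff₀ (by linarith)]
          gcongr
  have := mul_nonneg hK (Real.log_nonneg hR)
  linarith

namespace HalfPlaneDecay

variable {f : ℂ → ℂ} {K : ℝ}

lemma norm_deriv_neg_nat_le (hf : HalfPlaneDecay f K) (m : ℕ) :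
    ‖deriv f (-((m : ℂ) + 1))‖ ≤ 4 * K * (1 / ((m : ℝ) + 1) ^ 2) := by
  refine (hf.norm_deriv_le (r := (m : ℝ) + 1) ?_ (by simp)).trans (le_of_eq (by ring))
  have : (0 : ℝ) ≤ m := m.cast_nonneg
  linarith

lemma summable_deriv (hf : HalfPlaneDecay f K) :
    Summable fun m : ℕ => deriv f (-((m : ℂ) + 1)) :=
  Summable.of_norm_bounded (summable_one_div_succ_sq.mul_left _) hf.norm_deriv_neg_nat_le

lemma norm_tsum_deriv_le (hf : HalfPlaneDecay f K) :
    ‖∑' m : ℕ, deriv f (-((m : ℂ) + 1))‖ ≤ 4 * K * ∑' m : ℕ, 1 / ((m : ℝ) + 1) ^ 2 := by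
  rw [← tsum_mul_left]
  exact tsum_of_norm_bounded (summable_one_div_succ_sq.mul_left _).hasSum hf.norm_deriv_neg_nat_le

lemma hasSum_telescope (hf : HalfPlaneDecay f K) :
    HasSum (fun m : ℕ => f (-((m : ℂ) + 1)) - f (-((m : ℂ) + 2))) (f (-1)) := by
  have hb : ∀ m : ℕ, ‖f (-((m : ℂ) + 1)) - f (-((m : ℂ) + 2))‖ ≤
      4 * K * (1 / ((m : ℝ) + 1) ^ 2) := by
    intro m
    have h0 : (0 : ℝ) ≤ m := m.cast_nonneg
    refine (hf.norm_sub_le (r := (m : ℝ) + 1) (by linarith) (by simp) (by simp)).trans (le_of_eq ?_)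
    rw [show -((m : ℂ) + 1) - -((m : ℂ) + 2) = 1 by ring, norm_one]
    ring
  rw [(Summable.of_norm_bounded (summable_one_div_succ_sq.mul_left _) hb).hasSum_iff_tendsto_nat]
  have h1 : ∀ n : ℕ, ∑ m ∈ Finset.range n, (f (-((m : ℂ) + 1)) - f (-((m : ℂ) + 2))) =
      f (-1) - f (-((n : ℂ) + 1)) := by
    intro n
    have := Finset.sum_range_sub' (fun m : ℕ => f (-((m : ℂ) + 1))) n
    simp only [Nat.cast_add, Nat.cast_one, Nat.cast_zero, zero_add, add_assoc, one_add_one_eq_two]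
      at this ⊢
    exact this
  simp_rw [h1]
  have h2 : Tendsto (fun n : ℕ => f (-((n : ℂ) + 1))) atTop (𝓝 0) := by
    refine squeeze_zero_norm (a := fun n : ℕ => K / ((n : ℝ) + 1)) (fun n => ?_)
      (tendsto_const_div_atTop_nhds_zero_nat K |>.comp (tendsto_add_atTop_nat 1) |>.congr
        fun n => by simp)
    have h0 : (0 : ℝ) ≤ n := n.cast_nonneg
    exact hf.norm_le (by linarith) (by simp)
  simpa using h2.const_sub (f (-1))

/-- Behaviour of `T f` near `1`. -/
lemma norm_Tbrj_near_one_le (hf : HalfPlaneDecay f K) {z : ℂ} (hz : 1 ≤ ‖z‖) :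
    ‖Tbrj f z + z * f (z⁻¹ - 1) - ∑' m : ℕ, deriv f (-((m : ℂ) + 1))‖ ≤
      4 * K * (∑' m : ℕ, 1 / ((m : ℝ) + 1) ^ 2) * ‖z - 1‖ := by
  have hz0 : z ≠ 0 := by rintro rfl; norm_num at hz
  have hre : (z⁻¹).re ≤ 1 := (Complex.re_le_norm _).trans (by
    rw [norm_inv]; exact inv_le_one_of_one_le₀ hz)
  have hnorm : ‖z‖ * ‖z⁻¹ - 1‖ = ‖z - 1‖ := by
    rw [← norm_mul, mul_sub, mul_inv_cancel₀ hz0, mul_one, norm_sub_rev]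
  set d : ℕ → ℂ := fun m => f (z⁻¹ - ((m : ℂ) + 2)) - f (-((m : ℂ) + 1)) with hd
  have hdb : ∀ m, ‖d m‖ ≤ 4 * K * ‖z⁻¹ - 1‖ * (1 / ((m : ℝ) + 1) ^ 2) := by
    intro m
    have h0 : (0 : ℝ) ≤ m := m.cast_nonneg
    refine (hf.norm_sub_le (r := (m : ℝ) + 1) (by linarith) ?_ (by simp)).trans (le_of_eq ?_)
    · simp only [Complex.sub_re, Complex.add_re, Complex.natCast_re, Complex.re_ofNat]
      linarith
    · rw [show z⁻¹ - ((m : ℂ) + 2) - -((m : ℂ) + 1) = z⁻¹ - 1 by ring]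
      ring
  have hds := summable_one_div_succ_sq.mul_left (4 * K * ‖z⁻¹ - 1‖)
  have hdsum : ‖∑' m, d m‖ ≤ 4 * K * ‖z⁻¹ - 1‖ * ∑' m : ℕ, 1 / ((m : ℝ) + 1) ^ 2 := by
    rw [← tsum_mul_left]
    exact tsum_of_norm_bounded hds.hasSum hdb
  have hT : HasSum (fun m => Tterm f (m + 1) z)
      (-z * (∑' m, d m + f (-1)) + ∑' m : ℕ, deriv f (-(((m + 1 : ℕ) : ℂ) + 1))) := by
    have h1 := (((Summable.of_norm_bounded hds hdb).hasSum.add hf.hasSum_telescope).mul_left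
      (-z)).add ((summable_nat_add_iff 1).2 hf.summable_deriv).hasSum
    refine Eq.mp (congrArg (fun F : ℕ → ℂ => HasSum F _) (funext fun m => ?_)) h1
    simp only [Tterm, hd]
    rw [show (((m + 1 : ℕ) : ℂ) + 1) = (m : ℂ) + 2 by push_cast; ring]
    ring
  have hT' : Tbrj f z = Tterm f 0 z +
      (-z * (∑' m, d m + f (-1)) + ∑' m : ℕ, deriv f (-(((m + 1 : ℕ) : ℂ) + 1))) := by
    have hs : Summable fun m => Tterm f m z := (summable_nat_add_iff 1).1 hT.summable
    have h := hs.tsum_eq_zero_add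
    rwa [hT.tsum_eq] at h
  rw [hT', hf.summable_deriv.tsum_eq_zero_add]
  have : Tterm f 0 z + (-z * (∑' m, d m + f (-1)) +
      ∑' m : ℕ, deriv f (-(((m + 1 : ℕ) : ℂ) + 1))) + z * f (z⁻¹ - 1) -
      (deriv f (-(((0 : ℕ) : ℂ) + 1)) + ∑' m : ℕ, deriv f (-(((m + 1 : ℕ) : ℂ) + 1))) =
      -z * ∑' m, d m := by
    simp only [Tterm, Nat.cast_zero, zero_add]
    ring
  rw [this, norm_mul, norm_neg]
  calc ‖z‖ * ‖∑' m, d m‖ ≤ ‖z‖ * (4 * K * ‖z⁻¹ - 1‖ * ∑' m : ℕ, 1 / ((m : ℝ) + 1) ^ 2) := by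
        gcongr
    _ = _ := by rw [← hnorm]; ring

/-- Behaviour of `T f` near `0`. -/
lemma norm_Tbrj_near_zero_le (hf : HalfPlaneDecay f K) {w : ℂ} (hw0 : w ≠ 0) (hw : ‖w‖ ≤ 1)
    (hre : (w⁻¹).re ≤ 0) :
    ‖Tbrj f w - ∑' m : ℕ, deriv f (-((m : ℂ) + 1))‖ ≤
      8 * K * ‖w‖ * (1 + Real.log ‖w‖⁻¹) := by
  set x : ℕ → ℂ := fun m => f (w⁻¹ - ((m : ℂ) + 1)) - f (-((m : ℂ) + 1)) with hx
  have hm : ∀ m : ℕ, (w⁻¹ - ((m : ℂ) + 1)).re ≤ -((m : ℝ) + 1) := fun m => by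
    simp only [Complex.sub_re, Complex.add_re, Complex.natCast_re, Complex.one_re]
    linarith
  have h0 : ∀ m : ℕ, (0 : ℝ) ≤ m := fun m => m.cast_nonneg
  have h1 : ∀ m : ℕ, ‖x m‖ ≤ 2 * K / ((m : ℝ) + 1) := by
    intro m
    have ha := hf.norm_le (r := (m : ℝ) + 1) (by linarith [h0 m]) (hm m)
    have hb := hf.norm_le (r := (m : ℝ) + 1) (w := -((m : ℂ) + 1)) (by linarith [h0 m]) (by simp)
    refine (_root_.norm_sub_le _ _).trans ((add_le_add ha hb).trans (le_of_eq (by ring)))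
  have h2 : ∀ m : ℕ, ‖x m‖ ≤ 4 * K / ((m : ℝ) + 1) ^ 2 * ‖w‖⁻¹ := by
    intro m
    refine (hf.norm_sub_le (r := (m : ℝ) + 1) (by linarith [h0 m]) (hm m) (by simp)).trans
      (le_of_eq ?_)
    rw [show w⁻¹ - ((m : ℂ) + 1) - -((m : ℂ) + 1) = w⁻¹ by ring, norm_inv]
  have hxn : Summable fun m => ‖x m‖ := by
    refine Summable.of_nonneg_of_le (fun _ => norm_nonneg _) h2 ?_
    refine (summable_one_div_succ_sq.mul_left (4 * K * ‖w‖⁻¹)).congr fun m => by ring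
  have hT : Tbrj f w = -w * ∑' m, x m + ∑' m : ℕ, deriv f (-((m : ℂ) + 1)) :=
    ((hxn.of_norm.hasSum.mul_left (-w)).add hf.summable_deriv.hasSum).tsum_eq
  rw [hT, add_sub_cancel_right, norm_mul, norm_neg]
  have hR : 1 ≤ ‖w‖⁻¹ := (one_le_inv₀ (norm_pos_iff.2 hw0)).2 hw
  calc ‖w‖ * ‖∑' m, x m‖ ≤ ‖w‖ * ∑' m, ‖x m‖ := by
        gcongr
        exact norm_tsum_le_tsum_norm hxn
    _ ≤ ‖w‖ * (8 * K * (1 + Real.log ‖w‖⁻¹)) := by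
        gcongr
        exact tsum_le_log hR (fun _ => norm_nonneg _) h1 h2
    _ = _ := by ring

end HalfPlaneDecay

lemma Mmon_entries {g : Matrix (Fin 2) (Fin 2) ℤ} (hg : g ∈ Mmon) (h1 : g ≠ 1) :
    (g 0 0 * g 1 1 - g 0 1 * g 1 0 = 1 ∨ g 0 0 * g 1 1 - g 0 1 * g 1 0 = -1) ∧
      g 0 1 ≤ g 1 1 ∧ g 0 0 ≤ g 0 1 ∧ 0 ≤ g 0 0 ∧ g 1 0 ≤ g 1 1 ∧ g 0 0 ≤ g 1 0 ∧
      1 ≤ g 0 1 ∧ 1 ≤ g 1 0 := by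
  rcases hg with rfl | ⟨hdet, h2, h3, h4, h5, h6⟩
  · exact absurd rfl h1
  refine ⟨hdet, h2, h3, h4, h5, h6, ?_, ?_⟩
  · by_contra hb
    have hb0 : g 0 1 = 0 := by omega
    have ha0 : g 0 0 = 0 := by omega
    simp [ha0, hb0] at hdet
  · by_contra hb
    have hb0 : g 1 0 = 0 := by omega
    have ha0 : g 0 0 = 0 := by omega
    simp [ha0, hb0] at hdet

lemma one_le_of_mem_Mmon {g : Matrix (Fin 2) (Fin 2) ℤ} (hg : g ∈ Mmon) :
    1 ≤ g 1 1 ∧ 0 ≤ g 1 0 ∧ g 1 0 ≤ g 1 1 := by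
  by_cases h1 : g = 1
  · simp [h1]
  · obtain ⟨-, h2, -, -, h5, -, h7, h8⟩ := Mmon_entries hg h1
    omega

lemma gmat_mul (m : ℤ) (h : Matrix (Fin 2) (Fin 2) ℤ) :
    gmat m * h = !![h 1 0, h 1 1; h 0 0 + m * h 1 0, h 0 1 + m * h 1 1] := by
  ext i j
  fin_cases i <;> fin_cases j <;> simp [gmat, Matrix.mul_apply, Fin.sum_univ_two]

lemma gmat_mul_ne_one {m : ℤ} {h : Matrix (Fin 2) (Fin 2) ℤ} (hh : h ∈ Mmon) :
    gmat m * h ≠ 1 := by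
  intro he
  have h1 := congrFun (congrFun he 0) 1
  rw [gmat_mul] at h1
  have h2 := one_le_of_mem_Mmon hh
  simp at h1
  omega

lemma gmat_mul_mem_Mmon {m : ℤ} (hm : 1 ≤ m) {h : Matrix (Fin 2) (Fin 2) ℤ} (hh : h ∈ Mmon) :
    gmat m * h ∈ Mmon := by
  right
  rw [gmat_mul]
  by_cases h1 : h = 1
  · subst h1
    simp
    omega
  · obtain ⟨hdet, h2, h3, h4, h5, h6, h7, h8⟩ := Mmon_entries hh h1
    simp only [Matrix.of_apply, Matrix.cons_val', Matrix.cons_val_zero, Matrix.cons_val_one,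
      Matrix.cons_val_fin_one]
    refine ⟨?_, ?_, h5, by omega, ?_, ?_⟩
    · rcases hdet with hd | hd
      · right; linear_combination -hd
      · left; linear_combination -hd
    · nlinarith
    · nlinarith
    · nlinarith

/-- Left multiplication by the generators `g(m)`, `m ≥ 1`. -/
def genMul (p : ℕ × Mmon) : Mmon :=
  ⟨gmat ((p.1 : ℤ) + 1) * p.2.1, gmat_mul_mem_Mmon (by omega) p.2.2⟩

lemma genMul_injective : Function.Injective genMul := by
  rintro ⟨m, h, hh⟩ ⟨n, k, hk⟩ he
  have he' : gmat ((m : ℤ) + 1) * h = gmat ((n : ℤ) + 1) * k := congrArg Subtype.val he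
  rw [gmat_mul, gmat_mul] at he'
  have e00 := congrFun (congrFun he' 0) 0
  have e01 := congrFun (congrFun he' 0) 1
  have e10 := congrFun (congrFun he' 1) 0
  have e11 := congrFun (congrFun he' 1) 1
  simp only [Matrix.of_apply, Matrix.cons_val', Matrix.cons_val_zero, Matrix.cons_val_one,
    Matrix.cons_val_fin_one] at e00 e01 e10 e11
  by_cases h1 : h = 1
  · by_cases k1 : k = 1
    · subst h1 k1
      simp at e11
      simp [e11]
    · have := (Mmon_entries hk k1).2.2.2.2.2.2.2
      simp [h1] at e00
      omega
  · by_cases k1 : k = 1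
    · have := (Mmon_entries hh h1).2.2.2.2.2.2.2
      simp [k1] at e00
      omega
    · obtain ⟨-, h2, -, -, -, -, h7, -⟩ := Mmon_entries hh h1
      obtain ⟨-, k2, -, -, -, -, k7, -⟩ := Mmon_entries hk k1
      rw [← e00] at e10
      rw [← e01] at e11 k2
      have hmn : (m : ℤ) = n := by
        by_contra hne
        rcases lt_or_gt_of_ne hne with hlt | hlt <;> nlinarith
      rw [hmn] at e10 e11
      have hmn' : m = n := by exact_mod_cast hmn
      have : h = k := by
        ext i j
        fin_cases i <;> fin_cases j <;> simp <;> omega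
      subst hmn' this
      rfl

lemma range_genMul : range genMul = {g : Mmon | g.1 ≠ 1} := by
  ext ⟨g, hg⟩
  constructor
  · rintro ⟨p, hp⟩
    rw [mem_ofPred_eq, ← hp]
    exact gmat_mul_ne_one p.2.2
  intro h1
  obtain ⟨hdet, h2, h3, h4, h5, h6, h7, h8⟩ := Mmon_entries hg h1
  by_cases ha : g 0 0 = 0
  · have hbc : g 0 1 * g 1 0 = 1 := by
      rcases hdet with hd | hd
      · nlinarith
      · rw [ha] at hd; linarith
    have hb1 : g 0 1 = 1 := by nlinarith
    have hc1 : g 1 0 = 1 := by nlinarith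
    refine ⟨((g 1 1 - 1).toNat, ⟨1, Or.inl rfl⟩), Subtype.ext ?_⟩
    have hm : (((g 1 1 - 1).toNat : ℕ) : ℤ) = g 1 1 - 1 := Int.toNat_of_nonneg (by omega)
    simp only [genMul]
    rw [gmat_mul, hm]
    ext i j
    fin_cases i <;> fin_cases j <;> simp <;> omega
  · have ha1 : 1 ≤ g 0 0 := by omega
    set m := (g 1 1 - 1) / g 0 1 with hm
    set r := (g 1 1 - 1) % g 0 1 with hr
    have hr0 : 0 ≤ r := Int.emod_nonneg _ (by omega)
    have hrb : r < g 0 1 := Int.emod_lt_of_pos _ (by omega)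
    have hd : g 1 1 = r + 1 + m * g 0 1 := by
      have := Int.emod_add_mul_ediv (g 1 1 - 1) (g 0 1)
      rw [← hm, ← hr] at this
      linarith
    have hbd : g 0 1 < g 1 1 := by
      rcases h2.lt_or_eq with h | h
      · exact h
      · rw [← h] at hdet h5
        exfalso
        have hb1 : g 0 1 = 1 := by
          apply Int.eq_one_of_dvd_one (by omega)
          rcases hdet with hd | hd
          · exact ⟨g 0 0 - g 1 0, by linarith⟩
          · exact ⟨g 1 0 - g 0 0, by linarith⟩
        have hc1 : g 1 0 = 1 := by omega
        have ha1 : g 0 0 = 1 := by omega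
        rw [hb1, hc1, ha1] at hdet
        omega
    have hm1 : 1 ≤ m := by
      rw [hm, Int.le_ediv_iff_mul_le (by omega)]
      omega
    set a := g 1 0 - m * g 0 0 with ha'
    have hc : g 1 0 = a + m * g 0 0 := by omega
    have hdet' : a * g 0 1 - (r + 1) * g 0 0 = 1 ∨ a * g 0 1 - (r + 1) * g 0 0 = -1 := by
      rw [hd, hc] at hdet
      rcases hdet with h | h
      · right; linear_combination -h
      · left; linear_combination -h
    have hrc : (r + 1) * g 0 0 ≤ g 0 1 * g 0 0 := by nlinarith
    have hrc' : (r + 1) * g 0 0 ≤ (r + 1) * g 0 1 := by nlinarith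
    have hrc1 : 1 ≤ (r + 1) * g 0 0 := by nlinarith
    have hb2 : g 0 1 = 1 → a ≤ 1 := by
      intro hb
      have hg : g 0 0 = 1 := by omega
      rw [hb] at hd hrb
      rw [hg] at hc
      omega
    have hab : ∀ t, 1 ≤ t → (r + 1) * g 0 0 ≤ t * g 0 1 → a ≤ t := by
      intro t ht h
      by_contra hlt
      have h9 : (t + 1) * g 0 1 ≤ a * g 0 1 := by nlinarith
      have h10 : g 0 1 = 1 := by
        have : t * g 0 1 + g 0 1 ≤ t * g 0 1 + 1 := by
          rcases hdet' with h | h <;> linarith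
        omega
      have := hb2 h10
      omega
    refine ⟨((m - 1).toNat, ⟨!![a, r + 1; g 0 0, g 0 1], Or.inr ?_⟩), Subtype.ext ?_⟩
    · simp only [Matrix.of_apply, Matrix.cons_val', Matrix.cons_val_zero, Matrix.cons_val_one,
        Matrix.cons_val_fin_one]
      refine ⟨hdet', by omega, hab _ (by omega) hrc', ?_, h3,
        hab _ ha1 (by linarith)⟩
      by_contra hneg
      have : a * g 0 1 ≤ -1 * g 0 1 := by nlinarith
      rcases hdet' with h | h <;> nlinarith
    · have hm' : (((m - 1).toNat : ℕ) : ℤ) = m - 1 := Int.toNat_of_nonneg (by omega)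
      simp only [genMul]
      rw [gmat_mul, hm']
      ext i j
      fin_cases i <;> fin_cases j <;> simp <;> omega

/-- The weight `d⁻³` of `g = (a b; c d)`. -/
noncomputable def weight (g : Mmon) : ℝ := 1 / ((g.1 1 1 : ℤ) : ℝ) ^ 3

lemma weight_nonneg (g : Mmon) : 0 ≤ weight g := by
  have : (1 : ℝ) ≤ (g.1 1 1 : ℤ) := by exact_mod_cast (one_le_of_mem_Mmon g.2).1
  unfold weight
  positivity

lemma summable_weight : Summable weight := by
  have hp : Summable fun n : ℕ => (((n : ℝ) + 1) ^ (3 / 2 : ℝ))⁻¹ := by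
    simpa using (summable_nat_add_iff 1).2
      (Real.summable_nat_rpow_inv.2 (by norm_num : (1 : ℝ) < 3 / 2))
  have hpp := hp.mul_of_nonneg hp (fun n => by positivity) (fun n => by positivity)
  have hfin : Summable fun p : Bool × (ℕ × ℕ) =>
      (1 : ℝ) * (8 * ((((p.2.1 : ℝ) + 1) ^ (3 / 2 : ℝ))⁻¹ * (((p.2.2 : ℝ) + 1) ^ (3 / 2 : ℝ))⁻¹)) :=
    Summable.mul_of_nonneg (f := fun _ : Bool => (1 : ℝ)) (Summable.of_finite)
      (hpp.mul_left 8) (fun _ => zero_le_one) (fun p => by positivity)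
  set ι : Mmon → Bool × (ℕ × ℕ) := fun g =>
    (decide (g.1 0 0 * g.1 1 1 - g.1 0 1 * g.1 1 0 = 1), ((g.1 1 0).toNat, (g.1 1 1).toNat)) with hι
  have hinj : Function.Injective ι := by
    rintro ⟨g, hg⟩ ⟨h, hh⟩ he
    simp only [hι, Prod.mk.injEq, decide_eq_decide] at he
    obtain ⟨e1, e2, e3⟩ := he
    have hg0 := one_le_of_mem_Mmon hg
    have hh0 := one_le_of_mem_Mmon hh
    have hc : g 1 0 = h 1 0 := by omega
    have hd : g 1 1 = h 1 1 := by omega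
    apply Subtype.ext
    by_cases g1 : g = 1
    · by_cases h1 : h = 1
      · exact g1.trans h1.symm
      · have := (Mmon_entries hh h1).2.2.2.2.2.2.2
        simp [g1] at hc
        omega
    · by_cases h1 : h = 1
      · have := (Mmon_entries hg g1).2.2.2.2.2.2.2
        simp [h1] at hc
        omega
      obtain ⟨gd, g2, g3, g4, g5, g6, g7, g8⟩ := Mmon_entries hg g1
      obtain ⟨hdt, h2, h3, h4, h5, h6, h7, h8⟩ := Mmon_entries hh h1
      have hdet : g 0 0 * g 1 1 - g 0 1 * g 1 0 = h 0 0 * h 1 1 - h 0 1 * h 1 0 := by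
        rcases gd with gd | gd <;> rcases hdt with hdt | hdt <;> rw [gd, hdt] at e1 ⊢ <;>
          simp at e1
      rw [← hc, ← hd] at hdet
      have hcop : IsCoprime (g 1 1) (g 1 0) := by
        rcases gd with gd | gd
        · exact ⟨g 0 0, -g 0 1, by linear_combination gd⟩
        · exact ⟨-g 0 0, g 0 1, by linear_combination -gd⟩
      have hdvd : g 1 1 ∣ (g 0 1 - h 0 1) := by
        refine hcop.dvd_of_dvd_mul_right (z := g 1 0) ⟨g 0 0 - h 0 0, ?_⟩
        linear_combination -hdet
      have hb : g 0 1 = h 0 1 := by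
        have := Int.eq_zero_of_abs_lt_dvd hdvd (by rw [abs_lt]; omega)
        omega
      have ha : g 0 0 = h 0 0 := by
        rw [hb] at hdet
        have : g 0 0 * g 1 1 = h 0 0 * g 1 1 := by linarith
        exact mul_right_cancel₀ (by omega) this
      ext i j
      fin_cases i <;> fin_cases j <;> simp <;> assumption
  refine Summable.of_nonneg_of_le weight_nonneg (fun g => ?_) (hfin.comp_injective hinj)
  obtain ⟨h1, h2, h3⟩ := one_le_of_mem_Mmon g.2
  simp only [Function.comp, hι, weight]
  set c : ℤ := g.1 1 0
  set d : ℤ := g.1 1 1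
  have hc' : ((c.toNat : ℕ) : ℝ) = c := by exact_mod_cast Int.toNat_of_nonneg h2
  have hd' : ((d.toNat : ℕ) : ℝ) = d := by exact_mod_cast Int.toNat_of_nonneg (by omega)
  have hc0 : (0 : ℝ) ≤ c := by exact_mod_cast h2
  have hd1 : (1 : ℝ) ≤ d := by exact_mod_cast h1
  have hcd : (c : ℝ) ≤ d := by exact_mod_cast h3
  rw [hc', hd', one_mul, ← mul_inv, ← Real.mul_rpow (by positivity) (by positivity),
    ← div_eq_mul_inv, div_le_div_iff₀ (by positivity) (by positivity), one_mul]
  calc (((c : ℝ) + 1) * (d + 1)) ^ (3 / 2 : ℝ) ≤ ((2 * (d : ℝ)) ^ (2 : ℝ)) ^ (3 / 2 : ℝ) := by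
        apply Real.rpow_le_rpow (by positivity) _ (by norm_num)
        rw [Real.rpow_two]
        nlinarith
    _ = 8 * (d : ℝ) ^ 3 := by
        rw [← Real.rpow_mul (by positivity)]
        norm_num
        ring

section Lop

variable {g : Matrix (Fin 2) (Fin 2) ℤ} {w : ℂ}

lemma denom_re (g : Matrix (Fin 2) (Fin 2) ℤ) (w : ℂ) :
    ((g 0 0 : ℂ) - (g 1 0 : ℂ) * w).re = (g 0 0 : ℝ) - (g 1 0 : ℝ) * w.re := by
  simp

lemma denom_im (g : Matrix (Fin 2) (Fin 2) ℤ) (w : ℂ) :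
    ((g 0 0 : ℂ) - (g 1 0 : ℂ) * w).im = - ((g 1 0 : ℝ) * w.im) := by
  simp

lemma denom_re_gt (hg : g ∈ Mmon) (h1 : g ≠ 1) (hw : w.re < 0) :
    (g 0 0 : ℝ) < ((g 0 0 : ℂ) - (g 1 0 : ℂ) * w).re := by
  obtain ⟨-, -, -, -, -, -, -, hc⟩ := Mmon_entries hg h1
  have hc' : (1 : ℝ) ≤ g 1 0 := by exact_mod_cast hc
  rw [denom_re]
  nlinarith

lemma denom_ne_zero (hg : g ∈ Mmon) (h1 : g ≠ 1) (hw : w.re < 0) :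
    (g 0 0 : ℂ) - (g 1 0 : ℂ) * w ≠ 0 := by
  intro h
  have h2 := denom_re_gt hg h1 hw
  have ha : (0 : ℝ) ≤ g 0 0 := by exact_mod_cast (Mmon_entries hg h1).2.2.2.1
  rw [h, Complex.zero_re] at h2
  linarith

lemma mul_norm_le_norm_denom (hg : g ∈ Mmon) (h1 : g ≠ 1) (hw : w.re < 0) :
    (g 1 0 : ℝ) * ‖w‖ ≤ ‖(g 0 0 : ℂ) - (g 1 0 : ℂ) * w‖ := by
  obtain ⟨-, -, -, ha, -, -, -, hc⟩ := Mmon_entries hg h1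
  have hc' : (1 : ℝ) ≤ g 1 0 := by exact_mod_cast hc
  have ha' : (0 : ℝ) ≤ g 0 0 := by exact_mod_cast ha
  refine abs_le_of_sq_le_sq' ?_ (norm_nonneg _) |>.2
  rw [mul_pow, Complex.sq_norm, Complex.sq_norm, Complex.normSq_apply, Complex.normSq_apply,
    denom_re, denom_im]
  have : 0 ≤ (g 0 0 : ℝ) * ((g 1 0 : ℝ) * -w.re) := by
    apply mul_nonneg ha' (mul_nonneg (by linarith) (by linarith))
  nlinarith [sq_nonneg (g 0 0 : ℝ)]

lemma mobius_sub (hg : g ∈ Mmon) (h1 : g ≠ 1) (hw : w.re < 0) :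
    ((g 1 1 : ℂ) * w - (g 0 1 : ℂ)) / ((g 0 0 : ℂ) - (g 1 0 : ℂ) * w) -
      -(g 1 1 : ℂ) / (g 1 0 : ℂ) =
      ((g 0 0 * g 1 1 - g 0 1 * g 1 0 : ℤ) : ℂ) * ((g 1 0 : ℂ))⁻¹ *
        ((g 0 0 : ℂ) - (g 1 0 : ℂ) * w)⁻¹ := by
  have hs := denom_ne_zero hg h1 hw
  have hc : (g 1 0 : ℂ) ≠ 0 := by
    have := (Mmon_entries hg h1).2.2.2.2.2.2.2
    exact_mod_cast (by omega : g 1 0 ≠ 0)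
  push_cast
  generalize hsd : (g 0 0 : ℂ) - (g 1 0 : ℂ) * w = s at hs ⊢
  field_simp
  rw [← hsd]
  ring

lemma pole_re_le (hg : g ∈ Mmon) (h1 : g ≠ 1) :
    (-(g 1 1 : ℂ) / (g 1 0 : ℂ)).re ≤ -max 1 ((g 1 1 : ℝ) / (2 * g 1 0)) := by
  obtain ⟨-, -, -, -, hcd, -, -, hc⟩ := Mmon_entries hg h1
  have hc' : (1 : ℝ) ≤ g 1 0 := by exact_mod_cast hc
  have hcd' : (g 1 0 : ℝ) ≤ g 1 1 := by exact_mod_cast hcd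
  have : (-(g 1 1 : ℂ) / (g 1 0 : ℂ)) = ((-(g 1 1 : ℝ) / (g 1 0 : ℝ) : ℝ) : ℂ) := by
    push_cast
    rfl
  rw [this, Complex.ofReal_re, neg_div, neg_le_neg_iff]
  apply max_le
  · rw [le_div_iff₀ (by linarith)]
    linarith
  · apply div_le_div_of_nonneg_left <;> linarith

lemma mobius_re_le (hg : g ∈ Mmon) (h1 : g ≠ 1) (hw : w.re < 0) :
    (((g 1 1 : ℂ) * w - (g 0 1 : ℂ)) / ((g 0 0 : ℂ) - (g 1 0 : ℂ) * w)).re ≤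
      -max 1 ((g 1 1 : ℝ) / (2 * g 1 0)) := by
  obtain ⟨hdet, hbd, hab, ha, hcd, hac, hb, hc⟩ := Mmon_entries hg h1
  have hc' : (1 : ℝ) ≤ g 1 0 := by exact_mod_cast hc
  set s := (g 0 0 : ℂ) - (g 1 0 : ℂ) * w with hs
  have hsre : (g 0 0 : ℝ) < s.re := denom_re_gt hg h1 hw
  have ha' : (0 : ℝ) ≤ g 0 0 := by exact_mod_cast ha
  have hs0 : 0 < s.re := by linarith
  have hsinv0 : 0 ≤ (s⁻¹).re := by
    rw [Complex.inv_re]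
    exact div_nonneg hs0.le (Complex.normSq_nonneg _)
  have hsinv : (s⁻¹).re ≤ (s.re)⁻¹ := by
    have h2 : s.re * s.re ≤ Complex.normSq s := by
      rw [Complex.normSq_apply]
      nlinarith [mul_self_nonneg s.im]
    have h3 : 0 < s.re * s.re := by positivity
    rw [Complex.inv_re, div_le_iff₀ (by linarith), inv_mul_eq_div, le_div_iff₀ hs0]
    exact h2
  have hsub := congrArg Complex.re (mobius_sub hg h1 hw)
  rw [Complex.sub_re, ← hs] at hsub
  have hpole := pole_re_le hg h1
  have hpole_eq : (-(g 1 1 : ℂ) / (g 1 0 : ℂ)).re = -((g 1 1 : ℝ) / (g 1 0 : ℝ)) := by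
    rw [show (-(g 1 1 : ℂ) / (g 1 0 : ℂ)) = ((-((g 1 1 : ℝ) / (g 1 0 : ℝ)) : ℝ) : ℂ) by
      push_cast; ring, Complex.ofReal_re]
  have hR : (((g 0 0 * g 1 1 - g 0 1 * g 1 0 : ℤ) : ℂ) * ((g 1 0 : ℂ))⁻¹ * s⁻¹).re =
      ((g 0 0 * g 1 1 - g 0 1 * g 1 0 : ℤ) : ℝ) * (g 1 0 : ℝ)⁻¹ * (s⁻¹).re := by
    rw [← Complex.re_ofReal_mul]
    push_cast
    rfl
  rw [hR] at hsub
  rcases hdet with hd | hd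
  · have ha1 : 1 ≤ g 0 0 := by
      by_contra hne
      have : g 0 0 = 0 := by omega
      rw [this] at hd
      nlinarith
    have ha1' : (1 : ℝ) ≤ g 0 0 := by exact_mod_cast ha1
    have hab' : (g 0 0 : ℝ) ≤ g 0 1 := by exact_mod_cast hab
    have hd' : (g 0 0 : ℝ) * g 1 1 - g 0 1 * g 1 0 = 1 := by exact_mod_cast hd
    rw [hd, Int.cast_one, one_mul, hpole_eq] at hsub
    have h4 : (g 1 0 : ℝ)⁻¹ * (s⁻¹).re ≤ (g 1 0 : ℝ)⁻¹ * (g 0 0 : ℝ)⁻¹ := by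
      gcongr
      exact hsinv.trans (by gcongr)
    have h5 : (g 1 1 : ℝ) / (g 1 0 : ℝ) - (g 1 0 : ℝ)⁻¹ * (g 0 0 : ℝ)⁻¹ =
        (g 0 1 : ℝ) / (g 0 0 : ℝ) := by
      field_simp
      linarith
    have h6 : max 1 ((g 1 1 : ℝ) / (2 * g 1 0)) ≤ (g 0 1 : ℝ) / (g 0 0 : ℝ) := by
      apply max_le
      · rw [le_div_iff₀ (by linarith)]
        linarith
      · rw [div_le_div_iff₀ (by positivity) (by positivity)]
        nlinarith
    linarith
  · rw [hd] at hsub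
    push_cast at hsub
    have : 0 ≤ (g 1 0 : ℝ)⁻¹ * (s⁻¹).re := by positivity
    linarith

variable {φ : ℂ → ℂ} {K : ℝ}

lemma Lop_of_ne_one (h1 : g ≠ 1) (φ : ℂ → ℂ) : Lop g φ = fun z =>
    ((g 0 0 : ℂ) - (g 1 0 : ℂ) * z) *
        (φ (((g 1 1 : ℂ) * z - (g 0 1 : ℂ)) / ((g 0 0 : ℂ) - (g 1 0 : ℂ) * z)) -
          φ (-(g 1 1 : ℂ) / (g 1 0 : ℂ))) -
      ((g 0 0 * g 1 1 - g 0 1 * g 1 0 : ℤ) : ℂ) * ((g 1 0 : ℂ))⁻¹ *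
        deriv φ (-(g 1 1 : ℂ) / (g 1 0 : ℂ)) := by
  funext z
  simp [Lop, h1]

lemma Lop_one (φ : ℂ → ℂ) : Lop 1 φ = φ := by
  funext z
  simp [Lop]

lemma hasDerivAt_mobius (hg : g ∈ Mmon) (h1 : g ≠ 1) (hw : w.re < 0) :
    HasDerivAt (fun z => ((g 1 1 : ℂ) * z - (g 0 1 : ℂ)) / ((g 0 0 : ℂ) - (g 1 0 : ℂ) * z))
      (((g 0 0 * g 1 1 - g 0 1 * g 1 0 : ℤ) : ℂ) / ((g 0 0 : ℂ) - (g 1 0 : ℂ) * w) ^ 2) w := by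
  have hs := denom_ne_zero hg h1 hw
  have h2 := (((hasDerivAt_id' w).const_mul (g 1 1 : ℂ)).sub_const (g 0 1 : ℂ)).div
    (((hasDerivAt_id' w).const_mul (g 1 0 : ℂ)).const_sub (g 0 0 : ℂ)) hs
  refine h2.congr_deriv ?_
  push_cast
  congr 1
  ring

lemma hasDerivAt_Lop (hφ : HalfPlaneDecay φ K) (hg : g ∈ Mmon) (h1 : g ≠ 1) (hw : w.re < 0) :
    HasDerivAt (Lop g φ)
      (-(g 1 0 : ℂ) * (φ (((g 1 1 : ℂ) * w - (g 0 1 : ℂ)) / ((g 0 0 : ℂ) - (g 1 0 : ℂ) * w)) -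
          φ (-(g 1 1 : ℂ) / (g 1 0 : ℂ))) +
        ((g 0 0 * g 1 1 - g 0 1 * g 1 0 : ℤ) : ℂ) / ((g 0 0 : ℂ) - (g 1 0 : ℂ) * w) *
          deriv φ (((g 1 1 : ℂ) * w - (g 0 1 : ℂ)) / ((g 0 0 : ℂ) - (g 1 0 : ℂ) * w))) w := by
  have hs := denom_ne_zero hg h1 hw
  have hre := mobius_re_le hg h1 hw
  have hφd := (hφ.differentiableAt (lt_of_le_of_lt (hre.trans (neg_le_neg (le_max_left _ _)))
    (by norm_num))).hasDerivAt.comp w (hasDerivAt_mobius hg h1 hw)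
  have hden := ((hasDerivAt_id' w).const_mul (g 1 0 : ℂ)).const_sub (g 0 0 : ℂ)
  rw [Lop_of_ne_one h1]
  refine ((hden.mul (hφd.sub_const _)).sub_const _).congr_deriv ?_
  simp only [Function.comp]
  field_simp

lemma norm_Lop_le (hφ : HalfPlaneDecay φ K) (hg : g ∈ Mmon) (h1 : g ≠ 1) (hw : w.re < 0) :
    ‖Lop g φ w‖ ≤ 256 * K * (1 / (g 1 1 : ℝ) ^ 3) / ‖w‖ := by
  obtain ⟨hdet, -, -, -, hcd, -, -, hc⟩ := Mmon_entries hg h1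
  have hc' : (1 : ℝ) ≤ g 1 0 := by exact_mod_cast hc
  have hcd' : (g 1 0 : ℝ) ≤ g 1 1 := by exact_mod_cast hcd
  have hK := hφ.nonneg
  have hs := denom_ne_zero hg h1 hw
  have hsw := mul_norm_le_norm_denom hg h1 hw
  have hw0 : 0 < ‖w‖ := norm_pos_iff.2 (by rintro rfl; simp at hw)
  have hT := hφ.norm_taylor_le (le_max_left _ _) (mobius_re_le hg h1 hw) (pole_re_le hg h1)
  have hsub := mobius_sub hg h1 hw
  rw [Lop_of_ne_one h1]
  set s := (g 0 0 : ℂ) - (g 1 0 : ℂ) * w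
  set u := ((g 1 1 : ℂ) * w - (g 0 1 : ℂ)) / s
  set v := -(g 1 1 : ℂ) / (g 1 0 : ℂ)
  set ε : ℂ := ((g 0 0 * g 1 1 - g 0 1 * g 1 0 : ℤ) : ℂ) with hε
  have hε1 : ‖ε‖ = 1 := by
    rcases hdet with h | h <;> simp [hε, h]
  have heq : s * (φ u - φ v) - ε * (g 1 0 : ℂ)⁻¹ * deriv φ v =
      s * (φ u - φ v - deriv φ v * (u - v)) := by
    rw [hsub]
    field_simp
  have hnsub : ‖u - v‖ = (g 1 0 : ℝ)⁻¹ * ‖s‖⁻¹ := by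
    rw [hsub, norm_mul, norm_mul, hε1, norm_inv, norm_inv, one_mul, Complex.norm_intCast,
      abs_of_nonneg (by linarith)]
  have hs0 : 0 < ‖s‖ := norm_pos_iff.2 hs
  have hd0 : (0 : ℝ) < g 1 1 := by linarith
  show ‖s * (φ u - φ v) - ε * (g 1 0 : ℂ)⁻¹ * deriv φ v‖ ≤ _
  rw [heq, norm_mul]
  calc ‖s‖ * ‖φ u - φ v - deriv φ v * (u - v)‖
      ≤ ‖s‖ * (32 * K / ((g 1 1 : ℝ) / (2 * g 1 0)) ^ 3 * ((g 1 0 : ℝ)⁻¹ * ‖s‖⁻¹) ^ 2) := by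
        rw [← hnsub]
        gcongr
        refine hT.trans ?_
        gcongr
        exact le_max_right _ _
    _ = 256 * K * (1 / (g 1 1 : ℝ) ^ 3) * ((g 1 0 : ℝ) / ‖s‖) := by
        field_simp
        ring
    _ ≤ 256 * K * (1 / (g 1 1 : ℝ) ^ 3) * (1 / ‖w‖) := by
        refine mul_le_mul_of_nonneg_left ?_ (by positivity)
        rw [div_le_div_iff₀ hs0 hw0]
        linarith
    _ = _ := by ring

lemma HalfPlaneDecay.Lop (hφ : HalfPlaneDecay φ K) (g : Mmon) :
    HalfPlaneDecay (Lop g.1 φ) (256 * K * weight g) := by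
  by_cases h1 : g.1 = 1
  · have hK := hφ.nonneg
    rw [h1, Lop_one]
    refine ⟨hφ.1, fun w hw => (hφ.2 w hw).trans ?_⟩
    have : weight g = 1 := by simp [weight, h1]
    rw [this]
    gcongr
    linarith
  · refine ⟨fun w hw => (hasDerivAt_Lop hφ g.2 h1
      (lt_of_lt_of_le hw (by norm_num))).differentiableAt.differentiableWithinAt, fun w hw => ?_⟩
    exact norm_Lop_le hφ g.2 h1 (lt_of_lt_of_le hw (by norm_num))

/-- The cocycle relation `L_{g(m)h} = L_{g(m)} L_h`. -/
lemma Lop_gmat_mul (hφ : HalfPlaneDecay φ K) (hg : g ∈ Mmon) (m : ℕ) {z : ℂ} (hz : z ≠ 0)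
    (hre : (z⁻¹).re < 1) :
    Lop (gmat ((m : ℤ) + 1) * g) φ z = Tterm (Lop g φ) m z := by
  have hm0 : (0 : ℝ) ≤ m := m.cast_nonneg
  have hmre : (-((m : ℂ) + 1)).re < 0 := by simp; linarith
  have hzre : (z⁻¹ - ((m : ℂ) + 1)).re < 0 := by
    simp only [Complex.sub_re, Complex.add_re, Complex.natCast_re, Complex.one_re]
    linarith
  rw [Lop_of_ne_one (gmat_mul_ne_one hg), gmat_mul]
  simp only [Matrix.of_apply, Matrix.cons_val', Matrix.cons_val_zero, Matrix.cons_val_one,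
    Matrix.cons_val_fin_one, Tterm]
  by_cases h1 : g = 1
  · subst h1
    rw [Lop_one]
    simp
    have e1 : (((m : ℂ) + 1) * z - 1) / -z = z⁻¹ - ((m : ℂ) + 1) := by
      field_simp
      ring
    rw [e1]
    left
    ring
  · have hs := denom_ne_zero hg h1 hzre
    have ht := denom_ne_zero hg h1 hmre
    have hc : (g 1 0 : ℂ) ≠ 0 := by
      have := (Mmon_entries hg h1).2.2.2.2.2.2.2
      exact_mod_cast (by omega : g 1 0 ≠ 0)
    rw [(hasDerivAt_Lop hφ hg h1 hmre).deriv, Lop_of_ne_one h1]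
    push_cast
    set a : ℂ := (g 0 0 : ℂ)
    set b : ℂ := (g 0 1 : ℂ)
    set c : ℂ := (g 1 0 : ℂ)
    set d : ℂ := (g 1 1 : ℂ)
    set n : ℂ := (m : ℂ) + 1
    have hs' : c - (a + n * c) * z ≠ 0 := by
      intro h
      apply hs
      have h2 : (a - c * (z⁻¹ - n)) * z = -(c - (a + n * c) * z) := by
        field_simp
        ring
      rw [h, neg_zero] at h2
      exact (mul_eq_zero.1 h2).resolve_right hz
    have ht' : a + n * c ≠ 0 := fun h => ht (by linear_combination h)
    have e1 : (d * (z⁻¹ - n) - b) / (a - c * (z⁻¹ - n)) =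
        ((b + n * d) * z - d) / (c - (a + n * c) * z) := by
      rw [div_eq_div_iff hs hs']
      field_simp
      ring
    have e2 : (d * -n - b) / (a - c * -n) = -(b + n * d) / (a + n * c) := by
      rw [show a - c * -n = a + n * c by ring]
      congr 1
      ring
    rw [e1, e2]
    generalize φ (((b + n * d) * z - d) / (c - (a + n * c) * z)) = X
    generalize φ (-(b + n * d) / (a + n * c)) = Y
    generalize φ (-d / c) = W
    generalize deriv φ (-(b + n * d) / (a + n * c)) = V
    generalize deriv φ (-d / c) = U
    have ht'' : a - c * -n ≠ 0 := ht
    rw [show a - c * -n = a + n * c by ring]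
    field_simp
    ring

end Lop

section SumM

variable {φ : ℂ → ℂ} {K : ℝ}

lemma exists_norm_Lop_le_mul_weight (hφ : HalfPlaneDecay φ K) {w : ℂ} (hw : w.re < 0) :
    ∃ B : ℝ, 0 ≤ B ∧ ∀ g : Mmon, ‖Lop g.1 φ w‖ ≤ B * weight g := by
  have hK := hφ.nonneg
  refine ⟨256 * K / ‖w‖ + ‖φ w‖, by positivity, fun g => ?_⟩
  have hwt := weight_nonneg g
  by_cases h1 : g.1 = 1
  · have : weight g = 1 := by simp [weight, h1]
    rw [h1, Lop_one, this, mul_one]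
    exact le_add_of_nonneg_left (by positivity)
  · calc ‖Lop g.1 φ w‖ ≤ 256 * K * weight g / ‖w‖ := norm_Lop_le hφ g.2 h1 hw
      _ = 256 * K / ‖w‖ * weight g := by ring
      _ ≤ (256 * K / ‖w‖ + ‖φ w‖) * weight g := by
        gcongr
        exact le_add_of_nonneg_right (norm_nonneg _)

lemma summable_Lop (hφ : HalfPlaneDecay φ K) {w : ℂ} (hw : w.re < 0) :
    Summable fun g : Mmon => Lop g.1 φ w := by
  obtain ⟨B, -, hB⟩ := exists_norm_Lop_le_mul_weight hφ hw
  exact Summable.of_norm_bounded (summable_weight.mul_left B) hB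

lemma norm_Lop_le_mul_weight (hφ : HalfPlaneDecay φ K) {w : ℂ} (hw : w.re < -(1 / 7)) (g : Mmon) :
    ‖Lop g.1 φ w‖ ≤ 1792 * K * weight g := by
  refine ((hφ.Lop g).norm_le' hw).trans (le_of_eq (by ring))

lemma HalfPlaneDecay.sumM (hφ : HalfPlaneDecay φ K) :
    HalfPlaneDecay (sumM φ) (256 * K * ∑' g, weight g) := by
  refine ⟨Complex.differentiableOn_tsum_of_summable_norm (summable_weight.mul_left (1792 * K))
    (fun g => (hφ.Lop g).1) (Complex.isOpen_re_lt _) fun g _ hw => norm_Lop_le_mul_weight hφ hw g,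
    fun w hw => ?_⟩
  have h := (summable_weight.mul_left (256 * K)).hasSum.div_const ‖w‖
  rw [tsum_mul_left] at h
  exact tsum_of_norm_bounded h fun g => (hφ.Lop g).2 w hw

lemma hasSum_deriv_Lop (hφ : HalfPlaneDecay φ K) {w : ℂ} (hw : w.re < -(1 / 7)) :
    HasSum (fun g : Mmon => deriv (Lop g.1 φ) w) (deriv (sumM φ) w) :=
  Complex.hasSum_deriv_of_summable_norm (summable_weight.mul_left (1792 * K))
    (fun g => (hφ.Lop g).1) (Complex.isOpen_re_lt _)
    (fun g _ hw => norm_Lop_le_mul_weight hφ hw g) hw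

lemma re_inv_sub_nat_lt {z : ℂ} (hre : (z⁻¹).re < 1) (m : ℕ) :
    (z⁻¹ - ((m : ℂ) + 1)).re < -(m : ℝ) := by
  simp only [Complex.sub_re, Complex.add_re, Complex.natCast_re, Complex.one_re]
  linarith

lemma norm_Tterm_le (f : ℂ → ℂ) (m : ℕ) (z : ℂ) : ‖Tterm f m z‖ ≤
    ‖z‖ * ‖f (z⁻¹ - ((m : ℂ) + 1)) - f (-((m : ℂ) + 1))‖ + ‖deriv f (-((m : ℂ) + 1))‖ := by
  refine (norm_add_le _ _).trans (le_of_eq ?_)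
  rw [norm_mul, norm_neg]

lemma exists_norm_Tterm_Lop_le (hφ : HalfPlaneDecay φ K) {z : ℂ} (hz : z ≠ 0)
    (hre : (z⁻¹).re < 1) : ∃ C : ℝ, ∀ p : ℕ × Mmon,
      ‖Tterm (Lop p.2.1 φ) p.1 z‖ ≤ C * (1 / ((p.1 : ℝ) + 1) ^ 2 * weight p.2) := by
  have hK := hφ.nonneg
  have hw : (z⁻¹ - 1).re < 0 := by simpa using hre
  obtain ⟨B, hB0, hB⟩ := exists_norm_Lop_le_mul_weight hφ hw
  have hz0 : 0 < ‖z‖ := norm_pos_iff.2 hz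
  refine ⟨5120 * K + ‖z‖ * (B + 256 * K), fun ⟨m, h⟩ => ?_⟩
  have hf := hφ.Lop h
  have hwt := weight_nonneg h
  have hd := hf.norm_deriv_neg_nat_le m
  refine (norm_Tterm_le _ _ _).trans ?_
  show _ ≤ (5120 * K + ‖z‖ * (B + 256 * K)) * (1 / ((m : ℝ) + 1) ^ 2 * weight h)
  set f := Lop h.1 φ
  rcases Nat.eq_zero_or_pos m with rfl | hm
  · have hone : ‖f (-1)‖ ≤ 256 * K * weight h := by
      simpa using hf.norm_le (r := 1) (w := -1) (by norm_num) (by simp)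
    have hsub : ‖f (z⁻¹ - 1) - f (-1)‖ ≤ (B + 256 * K) * weight h :=
      (norm_sub_le _ _).trans (by linarith [hB h])
    simp only [Nat.cast_zero, zero_add] at hd ⊢
    norm_num at hd ⊢
    have := mul_le_mul_of_nonneg_left hsub hz0.le
    nlinarith [mul_nonneg hK hwt]
  · have hm1 : (1 : ℝ) ≤ m := by exact_mod_cast hm
    have hsub := hf.norm_sub_le (r := (m : ℝ)) (by linarith) (re_inv_sub_nat_lt hre m).le
      (v := -((m : ℂ) + 1)) (by simp)
    have hdiff : z⁻¹ - ((m : ℂ) + 1) - -((m : ℂ) + 1) = z⁻¹ := by ring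
    rw [hdiff, norm_inv] at hsub
    have hsq : 1 / (m : ℝ) ^ 2 ≤ 4 * (1 / ((m : ℝ) + 1) ^ 2) := by
      rw [mul_one_div, div_le_div_iff₀ (by positivity) (by positivity)]
      nlinarith
    have hmain : ‖z‖ * ‖f (z⁻¹ - ((m : ℂ) + 1)) - f (-((m : ℂ) + 1))‖ ≤
        4 * (256 * K * weight h) * (4 * (1 / ((m : ℝ) + 1) ^ 2)) :=
      calc _ ≤ ‖z‖ * (4 * (256 * K * weight h) / (m : ℝ) ^ 2 * ‖z‖⁻¹) := by gcongr
        _ = 4 * (256 * K * weight h) * (1 / (m : ℝ) ^ 2) := by field_simp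
        _ ≤ _ := by gcongr
    have hpos : 0 ≤ ‖z‖ * (B + 256 * K) * (1 / ((m : ℝ) + 1) ^ 2 * weight h) := by positivity
    linarith

/-- The identity `Σ_ℳ φ = φ + T (Σ_ℳ φ)`. -/
lemma sumM_eq_add_Tbrj (hφ : HalfPlaneDecay φ K) {z : ℂ} (hz : z ≠ 0) (hre : (z⁻¹).re < 1) :
    sumM φ z = φ z + Tbrj (sumM φ) z := by
  obtain ⟨C, hC⟩ := exists_norm_Tterm_Lop_le hφ hz hre
  have hsum : Summable fun p : ℕ × Mmon => Tterm (Lop p.2.1 φ) p.1 z :=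
    Summable.of_norm_bounded ((summable_one_div_succ_sq.mul_of_nonneg summable_weight
      (fun m => by positivity) weight_nonneg).mul_left C) hC
  have hinner (m : ℕ) : HasSum (fun h : Mmon => Tterm (Lop h.1 φ) m z) (Tterm (sumM φ) m z) := by
    have hm0 : (0 : ℝ) ≤ m := m.cast_nonneg
    have hv : (-((m : ℂ) + 1)).re < -(1 / 7) := by
      simp
      linarith
    exact (((summable_Lop hφ ((re_inv_sub_nat_lt hre m).trans_le (by linarith))).hasSum.sub
      (summable_Lop hφ (hv.trans (by norm_num))).hasSum).mul_left (-z)).add (hasSum_deriv_Lop hφ hv)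
  have hprod : HasSum (fun p : ℕ × Mmon => Tterm (Lop p.2.1 φ) p.1 z) (Tbrj (sumM φ) z) := by
    rw [hsum.hasSum_iff, hsum.tsum_prod' fun m => (hinner m).summable]
    exact tsum_congr fun m => (hinner m).tsum_eq
  set one : Mmon := ⟨1, Or.inl rfl⟩
  have hcompl : HasSum (fun g : Mmon => if g = one then 0 else Lop g.1 φ z)
      (Tbrj (sumM φ) z) := by
    rw [← genMul_injective.hasSum_iff]
    · convert hprod using 2 with p
      have hne : genMul p ≠ one := fun h => by
        have hp : genMul p ∈ range genMul := mem_range_self p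
        rw [range_genMul] at hp
        exact hp (congrArg Subtype.val h)
      rw [Function.comp_apply, if_neg hne]
      exact Lop_gmat_mul hφ p.2.2 p.1 hz hre
    · intro g hg
      rw [range_genMul] at hg
      have : g.1 = 1 := not_not.1 hg
      exact if_pos (Subtype.ext this)
  have hfull := (hasSum_ite_eq one (φ z)).add hcompl
  refine HasSum.tsum_eq ?_
  convert hfull using 2 with g
  by_cases h : g = one
  · simp [h, one, Lop_one]
  · simp [h]

end SumM

lemma re_inv_le_zero_of_norm_add_one_le {w : ℂ} (hw : ‖w + 1‖ ≤ 1) : (w⁻¹).re ≤ 0 := by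
  rw [Complex.inv_re]
  refine div_nonpos_of_nonpos_of_nonneg ?_ (Complex.normSq_nonneg _)
  have h : Complex.normSq (w + 1) ≤ 1 := by
    rw [Complex.normSq_eq_norm_sq]
    exact pow_le_one₀ (norm_nonneg _) hw
  rw [Complex.normSq_apply] at h
  simp at h
  nlinarith [sq_nonneg w.re, sq_nonneg w.im]

lemma re_inv_lt_one {z : ℂ} (hz : 1 ≤ ‖z‖) (hz1 : z ≠ 1) : (z⁻¹).re < 1 := by
  have hn : ‖z⁻¹‖ ≤ 1 := by
    rw [norm_inv]
    exact inv_le_one_of_one_le₀ hz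
  refine lt_of_le_of_ne ((Complex.re_le_norm _).trans hn) fun h => hz1 ?_
  have him : (z⁻¹).im = 0 := by
    have h2 : Complex.normSq z⁻¹ ≤ 1 := by
      rw [Complex.normSq_eq_norm_sq]
      exact pow_le_one₀ (norm_nonneg _) hn
    rw [Complex.normSq_apply, h] at h2
    exact mul_self_eq_zero.1 (le_antisymm (by linarith) (mul_self_nonneg _))
  exact inv_eq_one.1 (Complex.ext h him)

lemma norm_le_two_of_mem_D1set {z : ℂ} (hz : z ∈ D1set) : ‖z‖ ≤ 2 := by
  have h3 : (1 : ℝ) ≤ Real.sqrt 3 := Real.one_le_sqrt.2 (by norm_num)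
  have hinv : 1 / Real.sqrt 3 ≤ 1 := by
    rw [div_le_one (by linarith)]
    exact h3
  have hn : ‖((1 / Real.sqrt 3 : ℝ) : ℂ)‖ = 1 / Real.sqrt 3 := by
    rw [Complex.norm_real, Real.norm_of_nonneg (by positivity)]
  have := norm_le_norm_sub_add z ((1 / Real.sqrt 3 : ℝ) : ℂ)
  rw [hn] at this
  linarith [hz.2]

lemma norm_sub_one_le_of_mem_D1set {z : ℂ} (hz : z ∈ D1set) : ‖z - 1‖ ≤ 1 := by
  have h3 : (1 : ℝ) ≤ Real.sqrt 3 := Real.one_le_sqrt.2 (by norm_num)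
  have h := hz.2
  set r : ℝ := 1 / Real.sqrt 3
  have hr0 : 0 < r := by positivity
  have hr1 : r ≤ 1 := by
    rw [div_le_one (by linarith)]
    exact h3
  have h2 := pow_le_pow_left₀ (norm_nonneg _) h 2
  rw [Complex.sq_norm, Complex.normSq_apply] at h2
  simp only [Complex.sub_re, Complex.sub_im, Complex.ofReal_re, Complex.ofReal_im, sub_zero] at h2
  have hx : 0 ≤ z.re := by
    by_contra! hx
    nlinarith [mul_self_nonneg z.re, mul_self_nonneg z.im, mul_pos hr0 (neg_pos.2 hx)]
  refine abs_le_of_sq_le_sq' ?_ zero_le_one |>.2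
  rw [Complex.sq_norm, Complex.normSq_apply]
  simp only [Complex.sub_re, Complex.sub_im, Complex.one_re, Complex.one_im, sub_zero]
  nlinarith [mul_nonneg hx (sub_nonneg.2 hr1)]

lemma norm_sumM_near_one_le {φ : ℂ → ℂ} {K : ℝ} (hφ : HalfPlaneDecay φ K) {z : ℂ}
    (hz : z ∈ D1set) (hz1 : z ≠ 1) :
    ‖sumM φ z - φ z + z * φ (z⁻¹ - 1)‖ ≤
      256 * K * (∑' g, weight g) * (8 * (∑' m : ℕ, 1 / ((m : ℝ) + 1) ^ 2) + 16) * ‖z - 1‖ *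
        (1 + Real.log ‖z - 1‖⁻¹) := by
  have hψ := hφ.sumM
  have hK' := hψ.nonneg
  set K' := 256 * K * ∑' g, weight g
  set S := ∑' m : ℕ, 1 / ((m : ℝ) + 1) ^ 2
  have hS : 0 ≤ S := tsum_nonneg fun m => by positivity
  have hnz : 1 ≤ ‖z‖ := hz.1
  have hz0 : z ≠ 0 := by
    rintro rfl
    norm_num at hnz
  have hd0 : 0 < ‖z - 1‖ := norm_pos_iff.2 (sub_ne_zero.2 hz1)
  have hd1 := norm_sub_one_le_of_mem_D1set hz
  set w := z⁻¹ - 1 with hw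
  have hw0 : w ≠ 0 := fun h => hz1 (inv_eq_one.1 (sub_eq_zero.1 h))
  have hzw : ‖z‖ * ‖w‖ = ‖z - 1‖ := by
    rw [← norm_mul, hw, mul_sub, mul_inv_cancel₀ hz0, mul_one, norm_sub_rev]
  have hw1 : ‖w‖ ≤ 1 := by nlinarith [norm_nonneg w]
  have hwre : (w⁻¹).re ≤ 0 := by
    refine re_inv_le_zero_of_norm_add_one_le ?_
    rw [hw, sub_add_cancel, norm_inv]
    exact inv_le_one_of_one_le₀ hnz
  have hLnn : 0 ≤ Real.log ‖z - 1‖⁻¹ := Real.log_nonneg ((one_le_inv₀ hd0).2 hd1)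
  have hlog : Real.log ‖w‖⁻¹ ≤ 1 + Real.log ‖z - 1‖⁻¹ := by
    have h1 : ‖w‖⁻¹ = ‖z‖ * ‖z - 1‖⁻¹ := by
      rw [← hzw, mul_inv, mul_inv_cancel_left₀ (norm_ne_zero_iff.2 hz0)]
    rw [h1, Real.log_mul (norm_ne_zero_iff.2 hz0) (inv_ne_zero hd0.ne')]
    have h2 := Real.log_le_sub_one_of_pos (norm_pos_iff.2 hz0)
    linarith [norm_le_two_of_mem_D1set hz]
  have hone := hψ.norm_Tbrj_near_one_le hnz
  have hzero := hψ.norm_Tbrj_near_zero_le hw0 hw1 hwre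
  have hder := hψ.norm_tsum_deriv_le
  set D := ∑' m : ℕ, deriv (sumM φ) (-((m : ℂ) + 1))
  have heq : sumM φ z - φ z + z * φ w =
      (Tbrj (sumM φ) z + z * sumM φ w - D) - z * (Tbrj (sumM φ) w - D) - (z - 1) * D := by
    rw [sumM_eq_add_Tbrj hφ hz0 (re_inv_lt_one hnz hz1),
      sumM_eq_add_Tbrj hφ hw0 (hwre.trans_lt one_pos)]
    ring
  rw [heq]
  set L := Real.log ‖z - 1‖⁻¹
  have hfirst : 4 * K' * S * ‖z - 1‖ ≤ 4 * K' * S * ‖z - 1‖ * (1 + L) :=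
    le_mul_of_one_le_right (by positivity) (by linarith)
  calc _ ≤ 4 * K' * S * ‖z - 1‖ + ‖z‖ * (8 * K' * ‖w‖ * (1 + Real.log ‖w‖⁻¹)) +
        ‖z - 1‖ * (4 * K' * S) := by
        refine (norm_sub_le _ _).trans (add_le_add ((norm_sub_le _ _).trans ?_) ?_)
        · rw [norm_mul]
          gcongr
        · rw [norm_mul]
          gcongr
    _ = 4 * K' * S * ‖z - 1‖ + 8 * K' * ‖z - 1‖ * (1 + Real.log ‖w‖⁻¹) +
        4 * K' * S * ‖z - 1‖ := by
        rw [← hzw]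
        ring
    _ ≤ 4 * K' * S * ‖z - 1‖ * (1 + L) + 8 * K' * ‖z - 1‖ * (2 * (1 + L)) +
        4 * K' * S * ‖z - 1‖ * (1 + L) := by
        gcongr
        linarith
    _ = _ := by ring

/-- behaviour of `Tφ` and `Σ_ℳ φ` on `D₁`, near `1` (Proposition 4.2). -/
theorem boundary_behaviour_near_one :
    ∃ c > 0, ∀ φ ∈ O1 0 1, ∀ M : ℝ,
      (∀ w ∈ Dinf, ‖φ w‖ ≤ M) →
        ∀ z ∈ D1set \ {1},
          ‖Tbrj φ z + z * φ (z⁻¹ - 1) - ∑' m : ℕ, deriv φ (-((m : ℂ) + 1))‖ ≤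
              c * ‖z - 1‖ * M ∧
            ‖sumM φ z - φ z + z * φ (z⁻¹ - 1)‖ ≤
              c * ‖z - 1‖ * (1 + Real.log ‖z - 1‖⁻¹) * M := by
  set S := ∑' m : ℕ, 1 / ((m : ℝ) + 1) ^ 2
  set W := ∑' g, weight g
  have hS : 0 ≤ S := tsum_nonneg fun m => by positivity
  have hW : 0 ≤ W := tsum_nonneg weight_nonneg
  refine ⟨8 * S + 512 * W * (8 * S + 16) + 1, by positivity, fun φ hφ M hM z hz => ?_⟩
  obtain ⟨hzD, hz1⟩ := hz
  have hz1 : z ≠ 1 := hz1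
  have hf := halfPlaneDecay_of_mem_O1 hφ hM
  have hM0 : 0 ≤ M := by linarith [hf.nonneg]
  have hd0 : 0 < ‖z - 1‖ := norm_pos_iff.2 (sub_ne_zero.2 hz1)
  have hL : 0 ≤ Real.log ‖z - 1‖⁻¹ :=
    Real.log_nonneg ((one_le_inv₀ hd0).2 (norm_sub_one_le_of_mem_D1set hzD))
  constructor
  · calc _ ≤ 4 * (2 * M) * S * ‖z - 1‖ := hf.norm_Tbrj_near_one_le hzD.1
      _ = 8 * S * ‖z - 1‖ * M := by ring
      _ ≤ _ := by
        gcongr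
        linarith [mul_nonneg hW hS]
  · calc _ ≤ 256 * (2 * M) * W * (8 * S + 16) * ‖z - 1‖ * (1 + Real.log ‖z - 1‖⁻¹) :=
          norm_sumM_near_one_le hf hzD hz1
      _ = 512 * W * (8 * S + 16) * ‖z - 1‖ * (1 + Real.log ‖z - 1‖⁻¹) * M := by ring
      _ ≤ _ := by
        gcongr
        linarith
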